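/- Let ω(λ) and c(λ) solve the one-periodic-wave system a₁₁ω + a₁₂c = b₁, a₂₁ω + a₂₂c = b₂ (with coefficients as power series in λ, u₀ = 0, ρ ≠ 0), for λ in a punctured neighborhood of 0 where the determinant a₁₁a₂₂ − a₁₂a₂₁ ≠ 0. Then as λ → 0, c(λ) → 0 and ω(λ) → −3αk/ρ − 4π²α³. -/

import Mathlib

open Complex Asymptotics Filter

/-- `a₁₁(λ) = Σₙ -16π²n²ρ λ^{2n²}`. -/
noncomputable def a11 (ρ lam : ℂ) : ℂ :=
  ∑' n : ℤ, (-16 * (Real.pi : ℂ) ^ 2 * (n : ℂ) ^ 2 * ρ) * lam ^ (2 * n ^ 2).toNat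

/-- `a₁₂(λ) = Σₙ λ^{2n²}`. -/
noncomputable def a12 (lam : ℂ) : ℂ := ∑' n : ℤ, lam ^ (2 * n ^ 2).toNat

/-- `a₂₁(λ) = Σₙ -4π²(2n-1)²ρ λ^{2n²-2n+1}`. -/
noncomputable def a21 (ρ lam : ℂ) : ℂ :=
  ∑' n : ℤ, (-4 * (Real.pi : ℂ) ^ 2 * (2 * (n : ℂ) - 1) ^ 2 * ρ) *
    lam ^ (2 * n ^ 2 - 2 * n + 1).toNat

/-- `a₂₂(λ) = Σₙ λ^{2n²-2n+1}`. -/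
noncomputable def a22 (lam : ℂ) : ℂ := ∑' n : ℤ, lam ^ (2 * n ^ 2 - 2 * n + 1).toNat

/-- `b₁(λ) = Σₙ (48π²n²αk + 256π⁴n⁴ρα³) λ^{2n²}` (with `u₀ = 0`). -/
noncomputable def b1 (α ρ k lam : ℂ) : ℂ :=
  ∑' n : ℤ, (48 * (Real.pi : ℂ) ^ 2 * (n : ℂ) ^ 2 * α * k
    + 256 * (Real.pi : ℂ) ^ 4 * (n : ℂ) ^ 4 * ρ * α ^ 3) * lam ^ (2 * n ^ 2).toNat

/-- `b₂(λ) = Σₙ (12π²(2n-1)²αk + 16π⁴(2n-1)⁴ρα³) λ^{2n²-2n+1}` (with `u₀ = 0`). -/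
noncomputable def b2 (α ρ k lam : ℂ) : ℂ :=
  ∑' n : ℤ, (12 * (Real.pi : ℂ) ^ 2 * (2 * (n : ℂ) - 1) ^ 2 * α * k
    + 16 * (Real.pi : ℂ) ^ 4 * (2 * (n : ℂ) - 1) ^ 4 * ρ * α ^ 3) *
    lam ^ (2 * n ^ 2 - 2 * n + 1).toNat


lemma summable_aux (j : ℕ) : Summable (fun n : ℤ => ‖(n : ℂ) ^ j‖ * (1 / 2 : ℝ) ^ n.natAbs) := by
  have h := summable_pow_mul_geometric_of_norm_lt_one (R := ℝ) j (r := 1 / 2) (by norm_num)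
  apply Summable.of_nat_of_neg
  · simpa using h
  · simpa using h

lemma key_aux (f : ℤ → ℂ) (e : ℤ → ℕ) (p0 p1 p2 p3 p4 : ℂ)
    (hf : ∀ n : ℤ, f n = p0 + p1 * n + p2 * n ^ 2 + p3 * n ^ 3 + p4 * n ^ 4)
    (he : ∀ n, n.natAbs ≤ e n + 1) (s : Finset ℤ) (hs : ∀ n, n ∈ s ↔ e n = 0) :
    Tendsto (fun lam : ℂ => ∑' n : ℤ, f n * lam ^ e n) (nhdsWithin (0 : ℂ) {0}ᶜ)
      (nhds (∑ n ∈ s, f n)) := by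
  have hsum : Summable (fun n : ℤ => 2 * (‖f n‖ * (1 / 2 : ℝ) ^ n.natAbs)) := by
    apply Summable.mul_left
    have h := ((((summable_aux 0).mul_left ‖p0‖).add ((summable_aux 1).mul_left ‖p1‖)).add
      ((summable_aux 2).mul_left ‖p2‖)).add (((summable_aux 3).mul_left ‖p3‖).add
      ((summable_aux 4).mul_left ‖p4‖))
    refine Summable.of_nonneg_of_le (fun n => by positivity) (fun n => ?_) h
    have h1 : ‖f n‖ ≤ ‖p0‖ * ‖(n : ℂ) ^ 0‖ + ‖p1‖ * ‖(n : ℂ) ^ 1‖ + ‖p2‖ * ‖(n : ℂ) ^ 2‖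
        + ‖p3‖ * ‖(n : ℂ) ^ 3‖ + ‖p4‖ * ‖(n : ℂ) ^ 4‖ := by
      rw [hf]
      simp only [← norm_mul]
      refine (norm_add_le _ _).trans (add_le_add ((norm_add_le _ _).trans (add_le_add
        ((norm_add_le _ _).trans (add_le_add ((norm_add_le _ _).trans (add_le_add ?_ ?_)) ?_))
          ?_)) ?_) <;> simp
    have h2 : (0 : ℝ) ≤ (1 / 2 : ℝ) ^ n.natAbs := by positivity
    have h3 := mul_le_mul_of_nonneg_right h1 h2
    refine h3.trans (le_of_eq ?_)
    ring
  have hlim : ∑ n ∈ s, f n = ∑' n : ℤ, (if e n = 0 then f n else 0) := by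
    rw [tsum_eq_sum (s := s)]
    · exact Finset.sum_congr rfl (fun n hn => by simp [(hs n).1 hn])
    · intro n hn
      rw [if_neg (fun h => hn ((hs n).2 h))]
  rw [hlim]
  refine tendsto_tsum_of_dominated_convergence hsum ?_ ?_
  · intro n
    have hc : ContinuousAt (fun lam : ℂ => f n * lam ^ e n) 0 := by fun_prop
    have h := hc.tendsto
    have h0 : f n * (0 : ℂ) ^ e n = if e n = 0 then f n else 0 := by
      split_ifs with h
      · simp [h]
      · simp [h]
    rw [h0] at h
    exact h.mono_left nhdsWithin_le_nhds
  · have hb : ∀ᶠ lam : ℂ in nhdsWithin (0 : ℂ) {0}ᶜ, ‖lam‖ < 1 / 2 := by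
      apply nhdsWithin_le_nhds
      have := Metric.ball_mem_nhds (0 : ℂ) (show (0 : ℝ) < 1 / 2 by norm_num)
      filter_upwards [this] with x hx
      simpa using hx
    filter_upwards [hb] with lam hl n
    rw [norm_mul, norm_pow]
    have h1 : ‖lam‖ ^ e n ≤ (1 / 2 : ℝ) ^ e n := pow_le_pow_left₀ (norm_nonneg _) hl.le _
    have h2 : (1 / 2 : ℝ) ^ (e n + 1) ≤ (1 / 2 : ℝ) ^ n.natAbs :=
      pow_le_pow_of_le_one (by norm_num) (by norm_num) (he n)
    have h3 : ‖lam‖ ^ e n ≤ 2 * (1 / 2 : ℝ) ^ n.natAbs := by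
      rw [pow_succ] at h2; linarith
    have h4 := mul_le_mul_of_nonneg_left h3 (norm_nonneg (f n))
    linarith

lemma even_aux (f : ℤ → ℂ) (p0 p1 p2 p3 p4 : ℂ)
    (hf : ∀ n : ℤ, f n = p0 + p1 * n + p2 * n ^ 2 + p3 * n ^ 3 + p4 * n ^ 4) :
    Tendsto (fun lam : ℂ => ∑' n : ℤ, f n * lam ^ (2 * n ^ 2).toNat) (nhdsWithin (0 : ℂ) {0}ᶜ)
      (nhds (f 0)) := by
  have h := key_aux f (fun n => (2 * n ^ 2).toNat) p0 p1 p2 p3 p4 hf ?_ {0} ?_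
  · simpa using h
  · intro n
    have : |n| ≤ n ^ 2 := by
      rw [← sq_abs]; have := abs_nonneg n
      rcases eq_or_lt_of_le this with h | h
      · rw [← h]; norm_num
      · nlinarith
    have h1 := (le_abs_self n).trans this
    have h2 := (neg_le_abs n).trans this
    omega
  · intro n
    simp only [Finset.mem_singleton, Int.toNat_eq_zero]
    constructor
    · rintro rfl; norm_num
    · intro h; nlinarith [sq_nonneg n, pow_eq_zero_iff (two_ne_zero) |>.1 (le_antisymm (by linarith) (sq_nonneg n) : n ^ 2 = 0)]

lemma odd_aux (f : ℤ → ℂ) (p0 p1 p2 p3 p4 : ℂ)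
    (hf : ∀ n : ℤ, f n = p0 + p1 * n + p2 * n ^ 2 + p3 * n ^ 3 + p4 * n ^ 4) :
    Tendsto (fun lam : ℂ => (∑' n : ℤ, f n * lam ^ (2 * n ^ 2 - 2 * n + 1).toNat) / lam)
      (nhdsWithin (0 : ℂ) {0}ᶜ) (nhds (f 0 + f 1)) := by
  have hnn : ∀ n : ℤ, 0 ≤ n ^ 2 - n := by
    intro n
    rcases le_or_gt n 0 with h | h <;> nlinarith
  have h := key_aux f (fun n => (2 * n ^ 2 - 2 * n).toNat) p0 p1 p2 p3 p4 hf ?_ {0, 1} ?_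
  · rw [Finset.sum_pair (by norm_num)] at h
    refine h.congr' ?_
    filter_upwards [self_mem_nhdsWithin] with lam hl
    have hl : lam ≠ 0 := hl
    rw [eq_div_iff hl, ← tsum_mul_right]
    refine tsum_congr (fun n => ?_)
    have : (2 * n ^ 2 - 2 * n + 1).toNat = (2 * n ^ 2 - 2 * n).toNat + 1 := by
      have := hnn n; omega
    rw [this, pow_succ]; ring
  · intro n
    have h1 : n ≤ 2 * n ^ 2 - 2 * n + 1 := by
      rcases le_or_gt n 0 with h | h <;> nlinarith
    have h2 : -n ≤ 2 * n ^ 2 - 2 * n + 1 := by nlinarith [hnn n, sq_nonneg n]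
    omega
  · intro n
    simp only [Finset.mem_insert, Finset.mem_singleton, Int.toNat_eq_zero]
    constructor
    · rintro (rfl | rfl) <;> norm_num
    · intro h
      have h1 : n * (n - 1) = 0 := by have := hnn n; nlinarith
      rcases mul_eq_zero.1 h1 with h | h <;> omega

/-- If `(ω(λ), c(λ))` solves the one-periodic-wave linear system (with `u₀ = 0`, `ρ ≠ 0`)
on a punctured neighborhood of `λ = 0` where the determinant is nonzero, then
`c(λ) → 0` and `ω(λ) → -3αk/ρ - 4π²α³` as `λ → 0`. -/
theorem one_periodic_asymptotics (α ρ k : ℂ) (hρ : ρ ≠ 0) (ω c : ℂ → ℂ)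
    (hsys : ∀ᶠ lam in nhdsWithin (0 : ℂ) {0}ᶜ,
      (a11 ρ lam * a22 lam - a12 lam * a21 ρ lam ≠ 0) ∧
      a11 ρ lam * ω lam + a12 lam * c lam = b1 α ρ k lam ∧
      a21 ρ lam * ω lam + a22 lam * c lam = b2 α ρ k lam) :
    Tendsto c (nhdsWithin (0 : ℂ) {0}ᶜ) (nhds 0) ∧
    Tendsto ω (nhdsWithin (0 : ℂ) {0}ᶜ)
      (nhds (-3 * α * k / ρ - 4 * (Real.pi : ℂ) ^ 2 * α ^ 3)) := by
  have A11 : Tendsto (a11 ρ) (nhdsWithin (0 : ℂ) {0}ᶜ) (nhds 0) := by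
    have h := even_aux (fun n : ℤ => -16 * (Real.pi : ℂ) ^ 2 * (n : ℂ) ^ 2 * ρ)
      0 0 (-16 * (Real.pi : ℂ) ^ 2 * ρ) 0 0 (fun n => by ring)
    have e : -16 * (Real.pi : ℂ) ^ 2 * ((0 : ℤ) : ℂ) ^ 2 * ρ = 0 := by push_cast; ring
    simp only [e] at h
    exact h
  have A12 : Tendsto a12 (nhdsWithin (0 : ℂ) {0}ᶜ) (nhds 1) := by
    have h := even_aux (fun n : ℤ => 1) 1 0 0 0 0 (fun n => by ring)
    simp only [one_mul] at h
    exact h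
  have B1 : Tendsto (b1 α ρ k) (nhdsWithin (0 : ℂ) {0}ᶜ) (nhds 0) := by
    have h := even_aux (fun n : ℤ => 48 * (Real.pi : ℂ) ^ 2 * (n : ℂ) ^ 2 * α * k
      + 256 * (Real.pi : ℂ) ^ 4 * (n : ℂ) ^ 4 * ρ * α ^ 3)
      0 0 (48 * (Real.pi : ℂ) ^ 2 * α * k) 0 (256 * (Real.pi : ℂ) ^ 4 * ρ * α ^ 3)
      (fun n => by ring)
    have e : (48 * (Real.pi : ℂ) ^ 2 * ((0 : ℤ) : ℂ) ^ 2 * α * k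
      + 256 * (Real.pi : ℂ) ^ 4 * ((0 : ℤ) : ℂ) ^ 4 * ρ * α ^ 3) = 0 := by push_cast; ring
    simp only [e] at h
    exact h
  have A21 : Tendsto (fun lam => a21 ρ lam / lam) (nhdsWithin (0 : ℂ) {0}ᶜ)
      (nhds (-8 * (Real.pi : ℂ) ^ 2 * ρ)) := by
    have h := odd_aux (fun n : ℤ => -4 * (Real.pi : ℂ) ^ 2 * (2 * (n : ℂ) - 1) ^ 2 * ρ)
      (-4 * (Real.pi : ℂ) ^ 2 * ρ) (16 * (Real.pi : ℂ) ^ 2 * ρ) (-16 * (Real.pi : ℂ) ^ 2 * ρ) 0 0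
      (fun n => by ring)
    refine (congrArg (fun z => Tendsto _ _ (nhds z)) ?_).mp h
    push_cast; ring
  have A22 : Tendsto (fun lam => a22 lam / lam) (nhdsWithin (0 : ℂ) {0}ᶜ) (nhds 2) := by
    have h := odd_aux (fun n : ℤ => 1) 1 0 0 0 0 (fun n => by ring)
    simp only [one_mul] at h
    rw [one_add_one_eq_two] at h
    exact h
  have B2 : Tendsto (fun lam => b2 α ρ k lam / lam) (nhdsWithin (0 : ℂ) {0}ᶜ)
      (nhds (24 * (Real.pi : ℂ) ^ 2 * α * k + 32 * (Real.pi : ℂ) ^ 4 * ρ * α ^ 3)) := by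
    have h := odd_aux (fun n : ℤ => 12 * (Real.pi : ℂ) ^ 2 * (2 * (n : ℂ) - 1) ^ 2 * α * k
        + 16 * (Real.pi : ℂ) ^ 4 * (2 * (n : ℂ) - 1) ^ 4 * ρ * α ^ 3)
      (12 * (Real.pi : ℂ) ^ 2 * α * k + 16 * (Real.pi : ℂ) ^ 4 * ρ * α ^ 3)
      (-48 * (Real.pi : ℂ) ^ 2 * α * k - 128 * (Real.pi : ℂ) ^ 4 * ρ * α ^ 3)
      (48 * (Real.pi : ℂ) ^ 2 * α * k + 384 * (Real.pi : ℂ) ^ 4 * ρ * α ^ 3)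
      (-512 * (Real.pi : ℂ) ^ 4 * ρ * α ^ 3)
      (256 * (Real.pi : ℂ) ^ 4 * ρ * α ^ 3)
      (fun n => by ring)
    refine (congrArg (fun z => Tendsto _ _ (nhds z)) ?_).mp h
    push_cast; ring
  have hpi : (Real.pi : ℂ) ≠ 0 := by exact_mod_cast Real.pi_ne_zero
  have D := (A11.mul A22).sub (A12.mul A21)
  have hD : (0 : ℂ) * 2 - 1 * (-8 * (Real.pi : ℂ) ^ 2 * ρ) ≠ 0 := by
    have : (0 : ℂ) * 2 - 1 * (-8 * (Real.pi : ℂ) ^ 2 * ρ) = 8 * (Real.pi : ℂ) ^ 2 * ρ := by ring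
    rw [this]; exact mul_ne_zero (mul_ne_zero (by norm_num) (pow_ne_zero 2 hpi)) hρ
  have C := ((A11.mul B2).sub (A21.mul B1)).div D hD
  have W := ((B1.mul A22).sub (A12.mul B2)).div D hD
  constructor
  · have e : (0 * (24 * (Real.pi : ℂ) ^ 2 * α * k + 32 * (Real.pi : ℂ) ^ 4 * ρ * α ^ 3)
      - (-8 * (Real.pi : ℂ) ^ 2 * ρ) * 0) / (0 * 2 - 1 * (-8 * (Real.pi : ℂ) ^ 2 * ρ)) = 0 := by
      simp
    rw [e] at C
    refine C.congr' ?_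
    filter_upwards [hsys, self_mem_nhdsWithin] with lam ⟨hd, h1, h2⟩ hl
    have hl : lam ≠ 0 := hl
    have hd' : a11 ρ lam * (a22 lam / lam) - a12 lam * (a21 ρ lam / lam) ≠ 0 := by
      have : a11 ρ lam * (a22 lam / lam) - a12 lam * (a21 ρ lam / lam)
        = (a11 ρ lam * a22 lam - a12 lam * a21 ρ lam) / lam := by ring
      rw [this]; exact div_ne_zero hd hl
    simp only [Pi.div_apply]
    rw [div_eq_iff hd', ← h1, ← h2]
    ring
  · have e : (0 * 2 - 1 * (24 * (Real.pi : ℂ) ^ 2 * α * k + 32 * (Real.pi : ℂ) ^ 4 * ρ * α ^ 3))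
      / (0 * 2 - 1 * (-8 * (Real.pi : ℂ) ^ 2 * ρ))
      = -3 * α * k / ρ - 4 * (Real.pi : ℂ) ^ 2 * α ^ 3 := by
      rw [div_eq_iff hD]
      field_simp
      ring
    rw [e] at W
    refine W.congr' ?_
    filter_upwards [hsys, self_mem_nhdsWithin] with lam ⟨hd, h1, h2⟩ hl
    have hl : lam ≠ 0 := hl
    have hd' : a11 ρ lam * (a22 lam / lam) - a12 lam * (a21 ρ lam / lam) ≠ 0 := by
      have : a11 ρ lam * (a22 lam / lam) - a12 lam * (a21 ρ lam / lam)
        = (a11 ρ lam * a22 lam - a12 lam * a21 ρ lam) / lam := by ring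
      rw [this]; exact div_ne_zero hd hl
    simp only [Pi.div_apply]
    rw [div_eq_iff hd', ← h1, ← h2]
    ring
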